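/- Let O and N be points in the Euclidean plane and R > 0 with R/2 < dist(O,N) < 3R/2. Then there exist infinitely many nondegenerate triangles ABC with circumcenter O, circumradius R, and nine-point center N (i.e., with dist(O,A) = dist(O,B) = dist(O,C) = R and midpoint(O, orthocenter(ABC)) = N); moreover, every such triangle is obtuse (one of its angles is strictly greater than π/2). -/

import Mathlib

open EuclideanGeometry Real

lemma aux_dist (P Q : EuclideanSpace ℝ (Fin 2)) (R : ℝ) (hR : 0 < R) :
    dist P Q = R ↔ (Q 0 - P 0) ^ 2 + (Q 1 - P 1) ^ 2 = R ^ 2 := by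
  rw [EuclideanSpace.dist_eq, Fin.sum_univ_two, Real.sqrt_eq_iff_eq_sq (by positivity) hR.le,
    Real.dist_eq, Real.dist_eq, sq_abs, sq_abs]
  constructor <;> intro h <;> linarith

lemma aux_orth (O A B C : EuclideanSpace ℝ (Fin 2)) (R : ℝ)
    (h : AffineIndependent ℝ ![A, B, C]) (hA : dist O A = R) (hB : dist O B = R)
    (hC : dist O C = R) :
    Affine.Triangle.orthocenter ⟨![A, B, C], h⟩ = A + B + C - (2 : ℝ) • O := by
  set t : Affine.Triangle ℝ (EuclideanSpace ℝ (Fin 2)) := ⟨![A, B, C], h⟩ with ht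
  have hO : O = t.circumcenter := by
    apply t.eq_circumcenter_of_dist_eq (r := R)
    · have : affineSpan ℝ (Set.range t.points) = ⊤ := by
        apply t.independent.affineSpan_eq_top_iff_card_eq_finrank_add_one.2
        simp
      rw [this]; trivial
    · intro i
      fin_cases i <;> simp [ht, dist_comm _ O, hA, hB, hC]
  have := t.orthocenter_vsub_circumcenter_eq_sum_vsub
  rw [← hO, Fin.sum_univ_three] at this
  simp only [ht, vsub_eq_sub, Matrix.cons_val] at this
  rw [sub_eq_iff_eq_add] at this
  rw [this]
  module

lemma aux_mid (O A B C N : EuclideanSpace ℝ (Fin 2)) (R : ℝ)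
    (h : AffineIndependent ℝ ![A, B, C]) (hA : dist O A = R) (hB : dist O B = R)
    (hC : dist O C = R) :
    midpoint ℝ O (Affine.Triangle.orthocenter ⟨![A, B, C], h⟩) = N ↔
      (A 0 - O 0) + (B 0 - O 0) + (C 0 - O 0) = 2 * (N 0 - O 0) ∧
      (A 1 - O 1) + (B 1 - O 1) + (C 1 - O 1) = 2 * (N 1 - O 1) := by
  rw [aux_orth O A B C R h hA hB hC, midpoint_eq_smul_add, PiLp.ext_iff, Fin.forall_fin_two]
  simp only [PiLp.smul_apply, PiLp.add_apply, PiLp.sub_apply, smul_eq_mul, invOf_eq_inv]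
  constructor <;> rintro ⟨h1, h2⟩ <;> constructor <;> linarith

lemma aux_angle (A B C : EuclideanSpace ℝ (Fin 2)) (h : ¬ π / 2 < ∠ A B C) :
    0 ≤ (A 0 - B 0) * (C 0 - B 0) + (A 1 - B 1) * (C 1 - B 1) := by
  have h1 := InnerProductGeometry.cos_angle_mul_norm_mul_norm (A -ᵥ B) (C -ᵥ B)
  have h2 : 0 ≤ Real.cos (InnerProductGeometry.angle (A -ᵥ B) (C -ᵥ B)) :=
    Real.cos_nonneg_of_neg_pi_div_two_le_of_le
      (by linarith [InnerProductGeometry.angle_nonneg (A -ᵥ B) (C -ᵥ B), Real.pi_pos]) (not_lt.1 h)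
  have h3 : 0 ≤ inner ℝ (A -ᵥ B) (C -ᵥ B) := by
    rw [← h1]; positivity
  simp [PiLp.inner_apply, Fin.sum_univ_two] at h3
  linarith

/-- the algebraic core of obtuseness -/
lemma aux_alg (R a0 a1 b0 b1 c0 c1 : ℝ)
    (ha : a0 ^ 2 + a1 ^ 2 = R ^ 2) (hb : b0 ^ 2 + b1 ^ 2 = R ^ 2) (hc : c0 ^ 2 + c1 ^ 2 = R ^ 2) :
    R ^ 2 * (((b0 - a0) * (c0 - a0) + (b1 - a1) * (c1 - a1)) *
     ((a0 - b0) * (c0 - b0) + (a1 - b1) * (c1 - b1)) *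
     ((a0 - c0) * (b0 - c0) + (a1 - c1) * (b1 - c1))) * 8 =
    ((a0 - b0) ^ 2 + (a1 - b1) ^ 2) * ((b0 - c0) ^ 2 + (b1 - c1) ^ 2) *
      ((a0 - c0) ^ 2 + (a1 - c1) ^ 2) * (R ^ 2 - ((a0 + b0 + c0) ^ 2 + (a1 + b1 + c1) ^ 2)) := by
  obtain ⟨r, hr⟩ : ∃ r, r = R ^ 2 := ⟨_, rfl⟩
  obtain ⟨x, hx⟩ : ∃ x, x = a0 * b0 + a1 * b1 := ⟨_, rfl⟩
  obtain ⟨y, hy⟩ : ∃ y, y = b0 * c0 + b1 * c1 := ⟨_, rfl⟩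
  obtain ⟨z, hz⟩ : ∃ z, z = a0 * c0 + a1 * c1 := ⟨_, rfl⟩
  rw [← hr] at ha hb hc ⊢
  have hG : r * r * r + 2 * x * y * z - r * y ^ 2 - r * z ^ 2 - r * x ^ 2 = 0 := by
    have : (a0 ^ 2 + a1 ^ 2) * (b0 ^ 2 + b1 ^ 2) * (c0 ^ 2 + c1 ^ 2) + 2 * x * y * z
        - (a0 ^ 2 + a1 ^ 2) * y ^ 2 - (b0 ^ 2 + b1 ^ 2) * z ^ 2
        - (c0 ^ 2 + c1 ^ 2) * x ^ 2 = 0 := by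
      rw [hx, hy, hz]; ring
    rwa [ha, hb, hc] at this
  have t1 : (b0 - a0) * (c0 - a0) + (b1 - a1) * (c1 - a1) = r + y - x - z := by
    rw [hx, hy, hz]; linarith
  have t2 : (a0 - b0) * (c0 - b0) + (a1 - b1) * (c1 - b1) = r + z - x - y := by
    rw [hx, hy, hz]; linarith
  have t3 : (a0 - c0) * (b0 - c0) + (a1 - c1) * (b1 - c1) = r + x - y - z := by
    rw [hx, hy, hz]; linarith
  have s1 : (a0 - b0) ^ 2 + (a1 - b1) ^ 2 = 2 * (r - x) := by rw [hx]; linarith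
  have s2 : (b0 - c0) ^ 2 + (b1 - c1) ^ 2 = 2 * (r - y) := by rw [hy]; linarith
  have s3 : (a0 - c0) ^ 2 + (a1 - c1) ^ 2 = 2 * (r - z) := by rw [hz]; linarith
  have s4 : (a0 + b0 + c0) ^ 2 + (a1 + b1 + c1) ^ 2 = 3 * r + 2 * (x + y + z) := by
    rw [hx, hy, hz]; linarith
  rw [t1, t2, t3, s1, s2, s3, s4]
  linear_combination (24 * r - 8 * (x + y + z)) * hG

lemma aux_pos (A B : EuclideanSpace ℝ (Fin 2)) (h : A ≠ B) :
    0 < (A 0 - B 0) ^ 2 + (A 1 - B 1) ^ 2 := by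
  by_contra hn
  apply h
  ext i
  fin_cases i <;> simp <;> nlinarith [sq_nonneg (A 0 - B 0), sq_nonneg (A 1 - B 1)]

lemma aux_obtuse (O N : EuclideanSpace ℝ (Fin 2)) (R : ℝ) (hR : 0 < R)
    (hd : R ^ 2 < (2 * (N 0 - O 0)) ^ 2 + (2 * (N 1 - O 1)) ^ 2)
    (A B C : EuclideanSpace ℝ (Fin 2)) (h : AffineIndependent ℝ ![A, B, C])
    (hA : dist O A = R) (hB : dist O B = R) (hC : dist O C = R)
    (hN : midpoint ℝ O (Affine.Triangle.orthocenter ⟨![A, B, C], h⟩) = N) :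
    (π / 2 < ∠ B A C ∨ π / 2 < ∠ A B C ∨ π / 2 < ∠ B C A) := by
  by_contra hcon
  push Not at hcon
  obtain ⟨h1, h2, h3⟩ := hcon
  have h1 := aux_angle _ _ _ h1.not_gt
  have h2 := aux_angle _ _ _ h2.not_gt
  have h3 := aux_angle _ _ _ h3.not_gt
  obtain ⟨e0, e1⟩ := (aux_mid O A B C N R h hA hB hC).1 hN
  rw [aux_dist _ _ _ hR] at hA hB hC
  have key := aux_alg R _ _ _ _ _ _ hA hB hC
  rw [e0, e1] at key
  have hAB := aux_pos A B (fun e => by simpa using h.injective.ne (show (0 : Fin 3) ≠ 1 by decide) e)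
  have hBC := aux_pos B C (fun e => by simpa using h.injective.ne (show (1 : Fin 3) ≠ 2 by decide) e)
  have hAC := aux_pos A C (fun e => by simpa using h.injective.ne (show (0 : Fin 3) ≠ 2 by decide) e)
  simp only [sub_sub_sub_cancel_right] at key
  have p1 := mul_pos (mul_pos (mul_pos hAB hBC) hAC) (sub_pos.2 hd)
  have p2 := mul_nonneg (sq_nonneg R) (mul_nonneg (mul_nonneg h1 h2) h3)
  linarith

/-- for each admissible first vertex there is a triangle -/
lemma aux_exists (O N : EuclideanSpace ℝ (Fin 2)) (R : ℝ) (hR : 0 < R)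
    (hd : R ^ 2 < (2 * (N 0 - O 0)) ^ 2 + (2 * (N 1 - O 1)) ^ 2)
    (a0 a1 : ℝ) (ha : a0 ^ 2 + a1 ^ 2 = R ^ 2)
    (hh : (2 * (N 0 - O 0) - 2 * a0) ^ 2 + (2 * (N 1 - O 1) - 2 * a1) ^ 2 < R ^ 2) :
    ∃ (A B C : EuclideanSpace ℝ (Fin 2)) (h : AffineIndependent ℝ ![A, B, C]),
      A = !₂[O 0 + a0, O 1 + a1] ∧ dist O A = R ∧ dist O B = R ∧ dist O C = R ∧
        midpoint ℝ O (Affine.Triangle.orthocenter ⟨![A, B, C], h⟩) = N := by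
  obtain ⟨m0, hm0⟩ : ∃ m0, m0 = (2 * (N 0 - O 0) - a0) / 2 := ⟨_, rfl⟩
  obtain ⟨m1, hm1⟩ : ∃ m1, m1 = (2 * (N 1 - O 1) - a1) / 2 := ⟨_, rfl⟩
  have e0 : 2 * (N 0 - O 0) = 2 * m0 + a0 := by linarith
  have e1 : 2 * (N 1 - O 1) = 2 * m1 + a1 := by linarith
  rw [e0, e1] at hd hh
  have hmpos : 0 < m0 ^ 2 + m1 ^ 2 := by
    by_contra hn
    have z0 : m0 = 0 := by nlinarith [sq_nonneg m0, sq_nonneg m1]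
    have z1 : m1 = 0 := by nlinarith [sq_nonneg m0, sq_nonneg m1]
    subst z0 z1
    nlinarith
  have hmlt : m0 ^ 2 + m1 ^ 2 < R ^ 2 := by
    nlinarith [sq_nonneg (2 * m0 - 2 * a0), sq_nonneg (2 * m1 - 2 * a1)]
  obtain ⟨k, hk, hk2⟩ : ∃ k : ℝ, 0 < k ∧ (m0 ^ 2 + m1 ^ 2) * (1 + k ^ 2) = R ^ 2 := by
    have hp : 0 < R ^ 2 / (m0 ^ 2 + m1 ^ 2) - 1 := by
      rw [sub_pos, one_lt_div hmpos]; exact hmlt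
    refine ⟨√(R ^ 2 / (m0 ^ 2 + m1 ^ 2) - 1), Real.sqrt_pos.2 hp, ?_⟩
    rw [Real.sq_sqrt hp.le]
    field_simp
    ring
  have dA : dist O !₂[O 0 + a0, O 1 + a1] = R := by
    rw [aux_dist _ _ _ hR]; simp; linarith
  have dB : dist O !₂[O 0 + (m0 - k * m1), O 1 + (m1 + k * m0)] = R := by
    rw [aux_dist _ _ _ hR]; simp; linarith
  have dC : dist O !₂[O 0 + (m0 + k * m1), O 1 + (m1 - k * m0)] = R := by
    rw [aux_dist _ _ _ hR]; simp; linarith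
  have hind : AffineIndependent ℝ ![!₂[O 0 + a0, O 1 + a1],
      !₂[O 0 + (m0 - k * m1), O 1 + (m1 + k * m0)],
      !₂[O 0 + (m0 + k * m1), O 1 + (m1 - k * m0)]] := by
    have hcos : Cospherical ({!₂[O 0 + a0, O 1 + a1],
      !₂[O 0 + (m0 - k * m1), O 1 + (m1 + k * m0)],
      !₂[O 0 + (m0 + k * m1), O 1 + (m1 - k * m0)]} : Set (EuclideanSpace ℝ (Fin 2))) := by
      refine ⟨O, R, ?_⟩
      rintro p (rfl | rfl | rfl) <;> rw [dist_comm] <;> assumption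
    apply hcos.affineIndependent_of_ne
    · intro e
      have q0 := congrArg (fun x : EuclideanSpace ℝ (Fin 2) => x 0) e
      have q1 := congrArg (fun x : EuclideanSpace ℝ (Fin 2) => x 1) e
      simp at q0 q1
      rw [q0, q1] at hh
      nlinarith
    · intro e
      have q0 := congrArg (fun x : EuclideanSpace ℝ (Fin 2) => x 0) e
      have q1 := congrArg (fun x : EuclideanSpace ℝ (Fin 2) => x 1) e
      simp at q0 q1
      rw [q0, q1] at hh
      nlinarith
    · intro e
      have q0 := congrArg (fun x : EuclideanSpace ℝ (Fin 2) => x 0) e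
      have q1 := congrArg (fun x : EuclideanSpace ℝ (Fin 2) => x 1) e
      simp at q0 q1
      have z1 : k * m1 = 0 := by linarith
      have z0 : k * m0 = 0 := by linarith
      have z1 : m1 = 0 := by simpa [hk.ne'] using z1
      have z0 : m0 = 0 := by simpa [hk.ne'] using z0
      subst z0 z1
      simp at hmpos
  refine ⟨_, _, _, hind, rfl, dA, dB, dC, ?_⟩
  rw [aux_mid O _ _ _ N R hind dA dB dC]
  simp
  constructor <;> linarith

lemma aux_inf (h0 h1 R : ℝ) (hR : 0 < R) (hl : R ^ 2 < h0 ^ 2 + h1 ^ 2)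
    (hu : h0 ^ 2 + h1 ^ 2 < (3 * R) ^ 2) :
    {p : ℝ × ℝ | p.1 ^ 2 + p.2 ^ 2 = R ^ 2 ∧
      (h0 - 2 * p.1) ^ 2 + (h1 - 2 * p.2) ^ 2 < R ^ 2}.Infinite := by
  obtain ⟨d, hd, hd2⟩ : ∃ d : ℝ, 0 < d ∧ h0 ^ 2 + h1 ^ 2 = d ^ 2 :=
    ⟨√(h0 ^ 2 + h1 ^ 2), Real.sqrt_pos.2 (by nlinarith), (Real.sq_sqrt (by positivity)).symm⟩
  rw [hd2] at hl hu
  have hl' : R < d := lt_of_pow_lt_pow_left₀ 2 hd.le hl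
  have hu' : d < 3 * R := lt_of_pow_lt_pow_left₀ 2 (by positivity) hu
  have hs : (d ^ 2 + 3 * R ^ 2) / (4 * d * R) < 1 := by
    rw [div_lt_one (by positivity)]; nlinarith
  have hinj : Set.InjOn (fun s : ℝ => ((R / d * (s * h0 - √(1 - s ^ 2) * h1),
      R / d * (s * h1 + √(1 - s ^ 2) * h0)) : ℝ × ℝ))
      (Set.Ioo ((d ^ 2 + 3 * R ^ 2) / (4 * d * R)) 1) := by
    intro s _ t _ e
    simp only [Prod.mk.injEq] at e
    obtain ⟨q0, q1⟩ := e
    have hRd : R / d ≠ 0 := by positivity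
    have q0 := mul_left_cancel₀ hRd q0
    have q1 := mul_left_cancel₀ hRd q1
    have : d ^ 2 * s = d ^ 2 * t := by
      rw [← hd2]; linear_combination h0 * q0 + h1 * q1
    exact mul_left_cancel₀ (by positivity) this
  refine ((Set.Ioo_infinite hs).image hinj).mono ?_
  rintro _ ⟨s, ⟨hs0, hs1⟩, rfl⟩
  have hsp : 0 < s := lt_trans (by positivity) hs0
  have hw : √(1 - s ^ 2) ^ 2 = 1 - s ^ 2 := Real.sq_sqrt (by nlinarith)
  set w := √(1 - s ^ 2)
  obtain ⟨r, hr⟩ : ∃ r, r = R / d := ⟨_, rfl⟩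
  have hrd : r * d = R := by rw [hr]; field_simp
  rw [div_lt_iff₀ (by positivity)] at hs0
  simp only [← hr, Set.mem_ofPred_eq]
  have c1 : (r * (s * h0 - w * h1)) ^ 2 + (r * (s * h1 + w * h0)) ^ 2 = R ^ 2 := by
    have : (r * (s * h0 - w * h1)) ^ 2 + (r * (s * h1 + w * h0)) ^ 2
      = r ^ 2 * (s ^ 2 + w ^ 2) * (h0 ^ 2 + h1 ^ 2) := by ring
    rw [this, hw, hd2, ← hrd]; ring
  refine ⟨c1, ?_⟩
  have c2 : h0 * (r * (s * h0 - w * h1)) + h1 * (r * (s * h1 + w * h0)) = s * d * R := by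
    have : h0 * (r * (s * h0 - w * h1)) + h1 * (r * (s * h1 + w * h0))
      = r * s * (h0 ^ 2 + h1 ^ 2) := by ring
    rw [this, hd2, ← hrd]; ring
  nlinarith

/-- If `R/2 < dist O N < 3R/2`, there are infinitely many (unordered) triangles with
circumcenter `O`, circumradius `R` and nine-point center `N`, and every such triangle is
obtuse. -/
theorem infinite_triangles_sharing_circumcircle_euler_circle_obtuse
    (O N : EuclideanSpace ℝ (Fin 2)) (R : ℝ) (hR : 0 < R)
    (hd₁ : R / 2 < dist O N) (hd₂ : dist O N < 3 * R / 2) :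
    {s : Set (EuclideanSpace ℝ (Fin 2)) |
        ∃ (A B C : EuclideanSpace ℝ (Fin 2)) (h : AffineIndependent ℝ ![A, B, C]),
          s = {A, B, C} ∧ dist O A = R ∧ dist O B = R ∧ dist O C = R ∧
            midpoint ℝ O (Affine.Triangle.orthocenter ⟨![A, B, C], h⟩) = N}.Infinite ∧
      ∀ (A B C : EuclideanSpace ℝ (Fin 2)) (h : AffineIndependent ℝ ![A, B, C]),
        dist O A = R → dist O B = R → dist O C = R →
        midpoint ℝ O (Affine.Triangle.orthocenter ⟨![A, B, C], h⟩) = N →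
        (π / 2 < ∠ B A C ∨ π / 2 < ∠ A B C ∨ π / 2 < ∠ B C A) := by
  have hD := (aux_dist O N (dist O N) (by linarith)).1 rfl
  have hl : R ^ 2 < (2 * (N 0 - O 0)) ^ 2 + (2 * (N 1 - O 1)) ^ 2 := by nlinarith
  have hu : (2 * (N 0 - O 0)) ^ 2 + (2 * (N 1 - O 1)) ^ 2 < (3 * R) ^ 2 := by nlinarith
  refine ⟨?_, fun A B C h hA hB hC hN => aux_obtuse O N R hR hl A B C h hA hB hC hN⟩
  intro hfin
  have hU := Set.Finite.sUnion hfin (by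
    rintro t ⟨A, B, C, -, rfl, -⟩
    exact Set.toFinite _)
  have hinf := aux_inf _ _ R hR hl hu
  have hinj : Function.Injective
      (fun p : ℝ × ℝ => (!₂[O 0 + p.1, O 1 + p.2] : EuclideanSpace ℝ (Fin 2))) := by
    rintro ⟨p, q⟩ ⟨p', q'⟩ e
    have q0 := congrArg (fun x : EuclideanSpace ℝ (Fin 2) => x 0) e
    have q1 := congrArg (fun x : EuclideanSpace ℝ (Fin 2) => x 1) e
    simp at q0 q1
    simp [q0, q1]
  refine (hinf.image hinj.injOn) (hU.subset ?_)
  rintro _ ⟨⟨p, q⟩, ⟨hp1, hp2⟩, rfl⟩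
  obtain ⟨A, B, C, h, hA, hrest⟩ := aux_exists O N R hR hl p q hp1 hp2
  exact ⟨{A, B, C}, ⟨A, B, C, h, rfl, hrest⟩, by simp [hA]⟩
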